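/- For the trade-reduction (tr-DA) matching rule, the construction SNT^t := NT^t when |b^t|<2 or |s^t|<2, and SNT^t := ∅ otherwise, is a valid strong no-trade construction satisfying both conditions (a) and (b). -/

import Mathlib

/-!
STATEMENT 5: For the trade-reduction (tr-DA) matching rule, the construction
`SNT^t := NT^t` when `|b^t| < 2` or `|s^t| < 2`, and `SNT^t := ∅` otherwise, is a
valid strong no-trade construction satisfying both conditions (a) and (b).
-/

open Finset

attribute [local instance] Classical.propDecidable

noncomputable section

namespace TRDASnt

variable {nb ns : ℕ}

/-- `k`-th entry of the descending sequence of the values of the bids present in `B`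
(dummy `+∞` at index 0, `⊥` past the real bids). -/
def bSeq (B : Finset (Fin nb)) (b : Fin nb → ℝ) (k : ℕ) : EReal :=
  sSup {x : EReal | k ≤ (B.filter fun j => x ≤ (b j : EReal)).card}

/-- `k`-th entry of the descending sequence of the values of the asks present in `S`
(dummy `0` at index 0, `⊥` past the real asks). -/
def sSeq (S : Finset (Fin ns)) (s : Fin ns → ℝ) (k : ℕ) : EReal :=
  min 0 (sSup {x : EReal | k ≤ (S.filter fun j => x ≤ (s j : EReal)).card})

/-- Index of the last efficiently-clearing bid–ask pair. -/
def mIdx (B : Finset (Fin nb)) (S : Finset (Fin ns)) (b : Fin nb → ℝ)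
    (s : Fin ns → ℝ) : ℕ :=
  sSup {k : ℕ | 0 ≤ bSeq B b k + sSeq S s k}

/-- Rank of bid `i` among the bids present in `B` (ties broken by index). -/
def rankB (B : Finset (Fin nb)) (b : Fin nb → ℝ) (i : Fin nb) : ℕ :=
  1 + (B.filter fun j => b i < b j ∨ (b j = b i ∧ j < i)).card

/-- Rank of ask `j` among the asks present in `S`. -/
def rankS (S : Finset (Fin ns)) (s : Fin ns → ℝ) (j : Fin ns) : ℕ :=
  1 + (S.filter fun k => s j < s k ∨ (s k = s j ∧ k < j)).card

/-- Buyer `i` trades in the trade-reduction DA applied to `(B, S)`. -/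
def buyerTrades (B : Finset (Fin nb)) (S : Finset (Fin ns)) (b : Fin nb → ℝ)
    (s : Fin ns → ℝ) (i : Fin nb) : Prop :=
  i ∈ B ∧ 2 ≤ mIdx B S b s ∧ rankB B b i < mIdx B S b s

/-- Seller `j` trades in the trade-reduction DA applied to `(B, S)`. -/
def sellerTrades (B : Finset (Fin nb)) (S : Finset (Fin ns)) (b : Fin nb → ℝ)
    (s : Fin ns → ℝ) (j : Fin ns) : Prop :=
  j ∈ S ∧ 2 ≤ mIdx B S b s ∧ rankS S s j < mIdx B S b s

/-- A single-period market: the present bids and asks, their reported values and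
their reported departures. -/
structure Market (nb ns : ℕ) where
  B : Finset (Fin nb)
  S : Finset (Fin ns)
  bv : Fin nb → ℝ
  sv : Fin ns → ℝ
  bd : Fin nb → ℕ
  sd : Fin ns → ℕ

/-- An agent is either a bid or an ask. -/
abbrev Agent (nb ns : ℕ) := Fin nb ⊕ Fin ns

/-- The agent is present in the market. -/
def present (M : Market nb ns) : Agent nb ns → Prop
  | .inl i => i ∈ M.B
  | .inr j => j ∈ M.S

/-- Reported departure of an agent. -/
def dep (M : Market nb ns) : Agent nb ns → ℕ
  | .inl i => M.bd i
  | .inr j => M.sd j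

/-- Sign constraint on a replacement value: positive for bids, nonpositive for asks. -/
def signOK : Agent nb ns → ℝ → Prop
  | .inl _, v => 0 < v
  | .inr _, v => v ≤ 0

/-- Present bids have positive values and present asks nonpositive values. -/
def signValid (M : Market nb ns) : Prop :=
  (∀ i ∈ M.B, 0 < M.bv i) ∧ (∀ j ∈ M.S, M.sv j ≤ 0)

/-- The market after agent `x` changes its report to value `v` and departure `d`. -/
def updateReport (M : Market nb ns) : Agent nb ns → ℝ → ℕ → Market nb ns
  | .inl i, v, d =>
      { M with bv := Function.update M.bv i v, bd := Function.update M.bd i d }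
  | .inr j, v, d =>
      { M with sv := Function.update M.sv j v, sd := Function.update M.sd j d }

/-- The market with agent `x` absent. -/
def eraseAgent (M : Market nb ns) : Agent nb ns → Market nb ns
  | .inl i => { M with B := M.B.erase i }
  | .inr j => { M with S := M.S.erase j }

/-- Agent `x` trades in the trade-reduction DA applied to market `M`. -/
def trades (M : Market nb ns) : Agent nb ns → Prop
  | .inl i => buyerTrades M.B M.S M.bv M.sv i
  | .inr j => sellerTrades M.B M.S M.bv M.sv j

/-- `NT`: the present agents for which no trade is possible at any (sign-respecting)
replacement value. -/
def NT (M : Market nb ns) : Set (Agent nb ns) :=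
  {x | present M x ∧ ∀ v : ℝ, signOK x v → ¬ trades (updateReport M x v (dep M x)) x}

/-- The agents other than `x` that a construction `F` designates as strong no-trade
and that do not depart in period `t`. -/
def othersSNT (F : Market nb ns → Set (Agent nb ns)) (t : ℕ) (M : Market nb ns)
    (x : Agent nb ns) : Set (Agent nb ns) :=
  {y | y ∈ F M ∧ y ≠ x ∧ t < dep M y}

/-- Validity of a strong no-trade construction `F` in period `t`:
`F M ⊆ NT M`, condition (a) (membership of a non-departing no-trade agent in `F M` is
unchanged by its own alternate reports with departure after `t`), and condition (b)
(for a non-departing agent of `F M`, the set of other non-departing agents of `F M` is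
unchanged by its alternate reports with departure after `t`, and even by its absence
from the market). -/
def ValidSNT (t : ℕ) (F : Market nb ns → Set (Agent nb ns)) : Prop :=
  ∀ M : Market nb ns, signValid M →
    (F M ⊆ NT M) ∧
    (∀ x ∈ NT M, t < dep M x →
      ∀ (v : ℝ) (d' : ℕ), signOK x v → t < d' →
        (x ∈ F M ↔ x ∈ F (updateReport M x v d'))) ∧
    (∀ x ∈ F M, t < dep M x →
      ∀ (v : ℝ) (d' : ℕ), signOK x v → t < d' →
        othersSNT F t (updateReport M x v d') x = othersSNT F t M x ∧
          othersSNT F t (eraseAgent M x) x = othersSNT F t M x)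


lemma mIdx_le_one (B : Finset (Fin nb)) (S : Finset (Fin ns)) (b : Fin nb → ℝ)
    (s : Fin ns → ℝ) (h : B.card < 2 ∨ S.card < 2) : mIdx B S b s < 2 := by
  have key : ∀ k ∈ {k : ℕ | 0 ≤ bSeq B b k + sSeq S s k}, k ≤ 1 := by
    intro k hk
    by_contra hk1
    simp only [Set.mem_setOf_eq] at hk
    rcases h with h | h
    · have : bSeq B b k = ⊥ := by
        unfold bSeq
        rw [sSup_eq_bot]
        intro x hx
        have h1 : k ≤ (B.filter fun j => x ≤ (b j : EReal)).card := hx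
        have h2 := Finset.card_filter_le B (fun j => x ≤ (b j : EReal))
        omega
      rw [this, EReal.bot_add] at hk
      simp at hk
    · have : sSeq S s k = ⊥ := by
        unfold sSeq
        have : sSup {x : EReal | k ≤ (S.filter fun j => x ≤ (s j : EReal)).card} = ⊥ := by
          rw [sSup_eq_bot]
          intro x hx
          have h1 : k ≤ (S.filter fun j => x ≤ (s j : EReal)).card := hx
          have h2 := Finset.card_filter_le S (fun j => x ≤ (s j : EReal))
          omega
        rw [this]
        simp
      rw [this, EReal.add_bot] at hk
      simp at hk
  unfold mIdx
  rcases Set.eq_empty_or_nonempty {k : ℕ | 0 ≤ bSeq B b k + sSeq S s k} with he | hne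
  · rw [he]; simp
  · have := csSup_le hne key
    omega

lemma mem_NT_small (M : Market nb ns) (h : M.B.card < 2 ∨ M.S.card < 2)
    (x : Agent nb ns) : x ∈ NT M ↔ present M x := by
  refine ⟨fun hx => hx.1, fun hx => ⟨hx, fun v _ ht => ?_⟩⟩
  rcases x with i | j
  · have h1 := ht.2.1
    have h2 := mIdx_le_one M.B M.S (Function.update M.bv i v) M.sv h
    exact absurd h1 (not_le.mpr h2)
  · have h1 := ht.2.1
    have h2 := mIdx_le_one M.B M.S M.bv (Function.update M.sv j v) h
    exact absurd h1 (not_le.mpr h2)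

lemma update_small (M : Market nb ns) (x : Agent nb ns) (v : ℝ) (d : ℕ) :
    ((updateReport M x v d).B.card < 2 ∨ (updateReport M x v d).S.card < 2) ↔
      (M.B.card < 2 ∨ M.S.card < 2) := by
  rcases x with i | j <;> rfl

lemma update_present (M : Market nb ns) (x y : Agent nb ns) (v : ℝ) (d : ℕ) :
    present (updateReport M x v d) y ↔ present M y := by
  rcases x with i | j <;> rcases y with k | l <;> rfl

lemma update_dep (M : Market nb ns) (x y : Agent nb ns) (v : ℝ) (d : ℕ) (h : y ≠ x) :
    dep (updateReport M x v d) y = dep M y := by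
  rcases x with i | j <;> rcases y with k | l <;> simp_all [dep, updateReport]

lemma erase_small (M : Market nb ns) (x : Agent nb ns)
    (h : M.B.card < 2 ∨ M.S.card < 2) :
    (eraseAgent M x).B.card < 2 ∨ (eraseAgent M x).S.card < 2 := by
  rcases x with i | j
  · exact h.imp (fun h => lt_of_le_of_lt (Finset.card_le_card (Finset.erase_subset _ _)) h) id
  · exact h.imp id (fun h => lt_of_le_of_lt (Finset.card_le_card (Finset.erase_subset _ _)) h)

lemma erase_present (M : Market nb ns) (x y : Agent nb ns) (h : y ≠ x) :
    present (eraseAgent M x) y ↔ present M y := by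
  rcases x with i | j <;> rcases y with k | l <;> simp_all [present, eraseAgent]

lemma erase_dep (M : Market nb ns) (x y : Agent nb ns) :
    dep (eraseAgent M x) y = dep M y := by
  rcases x with i | j <;> rcases y with k | l <;> rfl

/-- **The "fewer than two bids or fewer than two asks" strong no-trade construction
is valid for the tr-DA matching rule.** -/
theorem snt_small_side_valid (nb ns t : ℕ) :
    ValidSNT t
      (fun M : Market nb ns =>
        if M.B.card < 2 ∨ M.S.card < 2 then NT M else ∅) := by
  intro M _
  by_cases h : M.B.card < 2 ∨ M.S.card < 2
  · refine ⟨?_, ?_, ?_⟩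
    · simp only [if_pos h]
      exact subset_rfl
    · intro x hx _ v d' _ _
      have hu := (update_small M x v d').mpr h
      simp only [if_pos h, if_pos hu]
      rw [mem_NT_small _ h, mem_NT_small _ hu, update_present]
    · intro x hx _ v d' _ _
      have hu := (update_small M x v d').mpr h
      have he := erase_small M x h
      constructor
      · ext y
        simp only [othersSNT, Set.mem_setOf_eq, if_pos h, if_pos hu]
        rw [mem_NT_small _ h, mem_NT_small _ hu, update_present]
        refine and_congr_right fun _ => and_congr_right fun hy => ?_
        rw [update_dep _ _ _ _ _ hy]
      · ext y
        simp only [othersSNT, Set.mem_setOf_eq, if_pos h, if_pos he]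
        rw [mem_NT_small _ h, mem_NT_small _ he, erase_dep]
        constructor
        · rintro ⟨a, b, c⟩
          exact ⟨(erase_present M x y b).mp a, b, c⟩
        · rintro ⟨a, b, c⟩
          exact ⟨(erase_present M x y b).mpr a, b, c⟩
  · refine ⟨?_, ?_, ?_⟩
    · simp only [if_neg h]
      exact Set.empty_subset _
    · intro x hx _ v d' _ _
      have hu := fun q => h ((update_small M x v d').mp q)
      simp only [if_neg h, if_neg hu]
    · intro x hx
      simp only [if_neg h] at hx
      exact hx.elim

end TRDASnt
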